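/- arXiv:2601.09857 — 4 statements merged into one kernel-verified Lean document; each statement's English description precedes it below -/
import Mathlib

section
/- Let τ_l < τ_u be real numbers and let J : [0,1] → ℝ be the quantile function of the standard truncated normal distribution TN(0,1,τ_l,τ_u), i.e., J(p) = Φ⁻¹(Φ(τ_l) + p(Φ(τ_u) − Φ(τ_l))). Then J is Lipschitz continuous on [0,1]; in fact, with M = (Φ(τ_u) − Φ(τ_l))/φ(max(|τ_l|, |τ_u|)), one has |J(p₁) − J(p₂)| ≤ M |p₁ − p₂| for all p₁, p₂ ∈ [0,1]. -/
open Real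

/-- The standard normal density `φ(x) = (1/√(2π)) e^{-x²/2}`. -/
noncomputable def stdPhi (x : ℝ) : ℝ := (Real.sqrt (2 * Real.pi))⁻¹ * Real.exp (-(x ^ 2) / 2)

/-- The standard normal cumulative distribution function `Φ`. -/
noncomputable def stdPhiCDF (x : ℝ) : ℝ := ∫ t in Set.Iic x, stdPhi t

theorem stdPhi_pos (x : ℝ) : 0 < stdPhi x := by
  unfold stdPhi
  positivity

theorem continuous_stdPhi : Continuous stdPhi := by
  unfold stdPhi
  fun_prop

theorem integrable_stdPhi : MeasureTheory.Integrable stdPhi := by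
  have hexp := (integrable_exp_neg_mul_sq (b := 1 / 2) (by norm_num)).const_mul
    (Real.sqrt (2 * Real.pi))⁻¹
  refine hexp.congr (Filter.Eventually.of_forall fun x => ?_)
  simp only [stdPhi]
  congr 2
  ring

theorem stdPhi_le_of_abs_le {x y : ℝ} (hxy : |x| ≤ y) : stdPhi y ≤ stdPhi x := by
  have hsq : x ^ 2 ≤ y ^ 2 := sq_le_sq.2 (hxy.trans (le_abs_self y))
  unfold stdPhi
  gcongr

theorem stdPhiCDF_sub (x y : ℝ) : stdPhiCDF y - stdPhiCDF x = ∫ t in x..y, stdPhi t :=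
  intervalIntegral.integral_Iic_sub_Iic integrable_stdPhi.integrableOn
    integrable_stdPhi.integrableOn

theorem continuous_stdPhiCDF : Continuous stdPhiCDF := by
  have heq : stdPhiCDF = fun x => stdPhiCDF 0 + ∫ t in (0 : ℝ)..x, stdPhi t := by
    funext x
    rw [← stdPhiCDF_sub]
    ring
  rw [heq]
  exact continuous_const.add
    (intervalIntegral.continuous_primitive
      (fun _ _ => integrable_stdPhi.intervalIntegrable) 0)

theorem stdPhi_mul_sub_le {x y c : ℝ} (hxy : x ≤ y) (hx : |x| ≤ c) (hy : |y| ≤ c) :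
    stdPhi c * (y - x) ≤ stdPhiCDF y - stdPhiCDF x := by
  have hmono := intervalIntegral.integral_mono_on (μ := MeasureTheory.volume) hxy
    (intervalIntegrable_const (c := stdPhi c)) (continuous_stdPhi.intervalIntegrable x y)
    fun t ht => stdPhi_le_of_abs_le
      (abs_le.2 ⟨(abs_le.1 hx).1.trans ht.1, ht.2.trans (abs_le.1 hy).2⟩)
  rw [intervalIntegral.integral_const, smul_eq_mul, mul_comm] at hmono
  rwa [stdPhiCDF_sub]

theorem stdPhi_mul_abs_sub_le {x y c : ℝ} (hx : |x| ≤ c) (hy : |y| ≤ c) :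
    stdPhi c * |x - y| ≤ |stdPhiCDF x - stdPhiCDF y| := by
  rcases le_total x y with hxy | hxy
  · rw [abs_sub_comm x, abs_sub_comm (stdPhiCDF x), abs_of_nonneg (sub_nonneg.2 hxy)]
    exact (stdPhi_mul_sub_le hxy hx hy).trans (le_abs_self _)
  · rw [abs_of_nonneg (sub_nonneg.2 hxy)]
    exact (stdPhi_mul_sub_le hxy hy hx).trans (le_abs_self _)

/-- The quantile function `J(p) = Φ⁻¹(Φ(τ_l) + p(Φ(τ_u) − Φ(τ_l)))` of the standard
truncated normal distribution `TN(0,1,τ_l,τ_u)` is Lipschitz on `[0,1]`, with explicit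
constant `M = (Φ(τ_u) − Φ(τ_l))/φ(max(|τ_l|, |τ_u|))`.  Here `Φinv` is the inverse
of `Φ` (characterized by `Φinv ∘ Φ = id`). -/
theorem stmt7 (τl τu : ℝ) (h : τl < τu)
    (Φinv : ℝ → ℝ) (hΦinv : ∀ x : ℝ, Φinv (stdPhiCDF x) = x)
    (J : ℝ → ℝ) (hJ : ∀ p : ℝ, J p = Φinv (stdPhiCDF τl + p * (stdPhiCDF τu - stdPhiCDF τl)))
    (M : ℝ) (hM : M = (stdPhiCDF τu - stdPhiCDF τl) / stdPhi (max |τl| |τu|)) :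
    (∀ p₁ ∈ Set.Icc (0 : ℝ) 1, ∀ p₂ ∈ Set.Icc (0 : ℝ) 1,
        |J p₁ - J p₂| ≤ M * |p₁ - p₂|) ∧
      LipschitzOnWith (Real.toNNReal M) J (Set.Icc 0 1) := by
  have hΔ : 0 ≤ stdPhiCDF τu - stdPhiCDF τl := by
    rw [stdPhiCDF_sub]
    exact intervalIntegral.integral_nonneg h.le fun t _ => (stdPhi_pos t).le
  have hφ := stdPhi_pos (max |τl| |τu|)
  have hM0 : 0 ≤ M := hM ▸ div_nonneg hΔ hφ.le
  have hquantile : ∀ p ∈ Set.Icc (0 : ℝ) 1, |J p| ≤ max |τl| |τu| ∧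
      stdPhiCDF (J p) = stdPhiCDF τl + p * (stdPhiCDF τu - stdPhiCDF τl) := by
    intro p hp
    obtain ⟨x, hx, hxp⟩ := intermediate_value_Icc h.le continuous_stdPhiCDF.continuousOn
      (show stdPhiCDF τl + p * (stdPhiCDF τu - stdPhiCDF τl) ∈
        Set.Icc (stdPhiCDF τl) (stdPhiCDF τu) from
        ⟨by nlinarith [mul_nonneg hp.1 hΔ],
          by nlinarith [mul_nonneg (sub_nonneg.2 hp.2) hΔ]⟩)
    rw [hJ, ← hxp, hΦinv]
    exact ⟨abs_le_max_abs_abs hx.1 hx.2, rfl⟩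
  have hbound : ∀ p₁ ∈ Set.Icc (0 : ℝ) 1, ∀ p₂ ∈ Set.Icc (0 : ℝ) 1,
      |J p₁ - J p₂| ≤ M * |p₁ - p₂| := by
    intro p₁ hp₁ p₂ hp₂
    obtain ⟨hb₁, he₁⟩ := hquantile p₁ hp₁
    obtain ⟨hb₂, he₂⟩ := hquantile p₂ hp₂
    have hle := stdPhi_mul_abs_sub_le hb₁ hb₂
    rw [he₁, he₂, add_sub_add_left_eq_sub, ← sub_mul, abs_mul, abs_of_nonneg hΔ] at hle
    rw [hM, div_mul_eq_mul_div, le_div_iff₀ hφ]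
    linarith
  refine ⟨hbound, LipschitzOnWith.of_dist_le_mul fun x hx y hy => ?_⟩
  rw [Real.coe_toNNReal M hM0, Real.dist_eq, Real.dist_eq]
  exact hbound x hx y hy
end

section
/- Let c_l > 0 and c_u > 0 be real numbers, let n ≥ 1 be an integer, and let k be an integer with 1 ≤ k ≤ n. Define the mean m(k) = (n c_l + k)/(n c_l + n c_u + n + 1) and the mode M(k) = (n c_l + k − 1)/(n c_l + n c_u + n − 1) of the Beta(n c_l + k, n c_u + n + 1 − k) distribution. Then both m(k) and M(k) lie strictly between (c_l + (k−1)/n)/(c_l + c_u + 1) and (c_l + k/n)/(c_l + c_u + 1); that is, (c_l + (k−1)/n)/(c_l + c_u + 1) < m(k) < (c_l + k/n)/(c_l + c_u + 1) and (c_l + (k−1)/n)/(c_l + c_u + 1) < M(k) < (c_l + k/n)/(c_l + c_u + 1). -/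
/-- For `c_l, c_u > 0`, `1 ≤ k ≤ n`, both the mean
`m(k) = (n c_l + k)/(n c_l + n c_u + n + 1)` and the mode
`M(k) = (n c_l + k − 1)/(n c_l + n c_u + n − 1)` of the
`Beta(n c_l + k, n c_u + n + 1 − k)` distribution lie strictly between
`(c_l + (k−1)/n)/(c_l + c_u + 1)` and `(c_l + k/n)/(c_l + c_u + 1)`. -/
theorem stmt9 (cl cu : ℝ) (hcl : 0 < cl) (hcu : 0 < cu) (n k : ℕ)
    (hn : 1 ≤ n) (hk1 : 1 ≤ k) (hkn : k ≤ n) :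
    ((cl + ((k : ℝ) - 1) / n) / (cl + cu + 1) <
        ((n : ℝ) * cl + k) / ((n : ℝ) * cl + n * cu + n + 1) ∧
      ((n : ℝ) * cl + k) / ((n : ℝ) * cl + n * cu + n + 1) <
        (cl + (k : ℝ) / n) / (cl + cu + 1)) ∧
    ((cl + ((k : ℝ) - 1) / n) / (cl + cu + 1) <
        ((n : ℝ) * cl + k - 1) / ((n : ℝ) * cl + n * cu + n - 1) ∧
      ((n : ℝ) * cl + k - 1) / ((n : ℝ) * cl + n * cu + n - 1) <
        (cl + (k : ℝ) / n) / (cl + cu + 1)) := by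
  have hn0 : (0 : ℝ) < n := by exact_mod_cast hn
  have hn1 : (1 : ℝ) ≤ n := by exact_mod_cast hn
  have hk1' : (1 : ℝ) ≤ k := by exact_mod_cast hk1
  have hkn' : (k : ℝ) ≤ n := by exact_mod_cast hkn
  have hncl : 0 < (n : ℝ) * cl := mul_pos hn0 hcl
  have hncu : 0 < (n : ℝ) * cu := mul_pos hn0 hcu
  have hlower : (cl + ((k : ℝ) - 1) / n) / (cl + cu + 1) =
      ((n : ℝ) * cl + k - 1) / ((n : ℝ) * cl + n * cu + n) := by
    rw [← mul_div_mul_left _ _ hn0.ne', mul_add, mul_div_cancel₀ _ hn0.ne']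
    ring
  have hupper : (cl + (k : ℝ) / n) / (cl + cu + 1) =
      ((n : ℝ) * cl + k) / ((n : ℝ) * cl + n * cu + n) := by
    rw [← mul_div_mul_left _ _ hn0.ne', mul_add, mul_div_cancel₀ _ hn0.ne']
    ring
  rw [hlower, hupper]
  obtain ⟨A, hA⟩ : ∃ A, A = (n : ℝ) * cl + k := ⟨_, rfl⟩
  obtain ⟨S, hS⟩ : ∃ S, S = (n : ℝ) * cl + n * cu + n := ⟨_, rfl⟩
  rw [← hA, ← hS]
  have hA1 : 1 < A := by linarith
  have hAS : A < S := by linarith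
  refine ⟨⟨?_, ?_⟩, ?_, ?_⟩ <;> rw [div_lt_div_iff₀ (by linarith) (by linarith)] <;> nlinarith
end

section
/- Let c_l > 0 and c_u > 0 be real numbers, let n ≥ 1 be an integer, and let k be an integer with 1 ≤ k ≤ n, and suppose the Beta shape parameters a = n c_l + k and b = n c_u + n + 1 − k both exceed 1. Let m ∈ (0,1) be a median of the Beta(a,b) distribution, i.e., ∫₀^m x^{a−1}(1−x)^{b−1} dx = (1/2)∫₀^1 x^{a−1}(1−x)^{b−1} dx. Then (c_l + (k−1)/n)/(c_l + c_u + 1) < m < (c_l + k/n)/(c_l + c_u + 1). -/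
open Real

lemma log_mul_lt_log_reflection {q w : ℝ} (hq : 0 < q) (hqw : q < w) (hw : w < 1) :
    (1 - q) * log (1 - w) + q * log w <
      (1 - q) * log (1 - q ^ 2 / w) + q * log (q ^ 2 / w) := by
  have hq1 : q < 1 := hqw.trans hw
  let φ : ℝ → ℝ := fun t =>
    (1 - q) * (log (t - q ^ 2) - log t - log (1 - t)) + q * (2 * log q - 2 * log t)
  have hderiv : ∀ t ∈ Set.Ico q 1, HasDerivAt φ
      ((1 - q) * (1 / (t - q ^ 2) - 1 / t - (-1) / (1 - t)) + q * (0 - 2 * (1 / t))) t := by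
    rintro t ⟨ht, ht1⟩
    have h0 : t ≠ 0 := by linarith
    have h1 : t - q ^ 2 ≠ 0 := by nlinarith
    have h2 : 1 - t ≠ 0 := by linarith
    exact (((((hasDerivAt_id t).sub_const (q ^ 2)).log h1).sub
      ((hasDerivAt_id t).log h0)).sub (((hasDerivAt_id t).const_sub 1).log h2)).const_mul (1 - q)
      |>.add (((hasDerivAt_const t (2 * log q)).sub
        (((hasDerivAt_id t).log h0).const_mul 2)).const_mul q)
  have hmono : StrictMonoOn φ (Set.Ico q 1) := by
    refine strictMonoOn_of_deriv_pos (convex_Ico q 1)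
      (fun t ht => (hderiv t ht).continuousAt.continuousWithinAt) fun t ht => ?_
    rw [interior_Ico] at ht
    rw [(hderiv t ⟨ht.1.le, ht.2⟩).deriv]
    obtain ⟨ht, ht1⟩ := ht
    have h0 : 0 < t := by linarith
    have h1 : 0 < t - q ^ 2 := by nlinarith
    have h2 : 0 < 1 - t := by linarith
    have key : (1 - q) * (1 / (t - q ^ 2) - 1 / t - (-1) / (1 - t)) + q * (0 - 2 * (1 / t)) =
        (1 + q) * (t - q) ^ 2 / (t * (t - q ^ 2) * (1 - t)) := by
      field_simp
      ring
    rw [key]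
    have : 0 < t - q := by linarith
    positivity
  have hlt := hmono ⟨le_rfl, hq1⟩ ⟨hqw.le, hw⟩ hqw
  have hw0 : 0 < w := hq.trans hqw
  have h1 : 0 < w - q ^ 2 := by nlinarith
  have e0 : φ q = 0 := by
    have : log (q - q ^ 2) = log q + log (1 - q) := by
      rw [← log_mul hq.ne' (by linarith)]
      ring_nf
    simp only [φ, this]
    ring
  have e1 : log (1 - q ^ 2 / w) = log (w - q ^ 2) - log w := by
    rw [← log_div h1.ne' hw0.ne', sub_div, div_self hw0.ne']
  have e2 : log (q ^ 2 / w) = 2 * log q - log w := by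
    rw [log_div (by positivity) hw0.ne', log_pow]
    norm_num
  rw [e0] at hlt
  rw [e1, e2]
  simp only [φ] at hlt
  linarith

lemma rpow_mul_rpow_lt_reflection {r s x : ℝ} (hr : 0 < r) (hs : 0 < s) (hx : 0 < x)
    (hxp : x < r / (r + s)) :
    x ^ r * (1 - x) ^ s <
      (1 - (s / (r + s)) ^ 2 / (1 - x)) ^ r * ((s / (r + s)) ^ 2 / (1 - x)) ^ s := by
  have hN : 0 < r + s := by positivity
  set q := s / (r + s) with hqdef
  have hq : 0 < q := by positivity
  have hpq : r / (r + s) = 1 - q := by rw [hqdef]; field_simp; ring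
  rw [hpq] at hxp
  have hx1 : 0 < 1 - x := by linarith
  have hlog := log_mul_lt_log_reflection hq (w := 1 - x) (by linarith) (by linarith)
  have hy : 0 < 1 - q ^ 2 / (1 - x) := by
    rw [sub_pos, div_lt_one hx1]
    nlinarith
  have hz : 0 < q ^ 2 / (1 - x) := by positivity
  rw [rpow_def_of_pos hx, rpow_def_of_pos hx1, rpow_def_of_pos hy, rpow_def_of_pos hz,
    ← exp_add, ← exp_add, exp_lt_exp]
  have hmul := mul_lt_mul_of_pos_left hlog hN
  have er : (r + s) * (1 - q) = r := by rw [← hpq]; field_simp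
  have es : (r + s) * q = s := by rw [hqdef]; field_simp
  rw [sub_sub_cancel, mul_add, mul_add, ← mul_assoc, ← mul_assoc, ← mul_assoc, ← mul_assoc,
    er, es] at hmul
  linarith

lemma continuous_rpow_mul_one_sub_rpow {r s : ℝ} (hr : 0 ≤ r) (hs : 0 ≤ s) :
    Continuous fun x : ℝ => x ^ r * (1 - x) ^ s :=
  (continuous_id.rpow_const fun _ => Or.inr hr).mul
    ((continuous_const.sub continuous_id).rpow_const fun _ => Or.inr hs)

lemma integral_rpow_mul_one_sub_rpow_mono {r s u v : ℝ} (hr : 0 ≤ r) (hs : 0 ≤ s)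
    (hu : 0 ≤ u) (huv : u ≤ v) (hv : v ≤ 1) :
    ∫ x in (0 : ℝ)..u, x ^ r * (1 - x) ^ s ≤ ∫ x in (0 : ℝ)..v, x ^ r * (1 - x) ^ s := by
  refine intervalIntegral.integral_mono_interval le_rfl hu huv ?_
    ((continuous_rpow_mul_one_sub_rpow hr hs).intervalIntegrable _ _)
  refine (MeasureTheory.ae_restrict_iff' measurableSet_Ioc).2 (.of_forall fun x hx => ?_)
  exact mul_nonneg (rpow_nonneg hx.1.le r) (rpow_nonneg (by linarith [hx.2]) s)

lemma two_mul_integral_rpow_mul_one_sub_rpow_lt {r s : ℝ} (hr : 0 < r) (hs : 0 < s) :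
    2 * ∫ x in (0 : ℝ)..(r / (r + (s + 1))), x ^ r * (1 - x) ^ s <
      ∫ x in (0 : ℝ)..1, x ^ r * (1 - x) ^ s := by
  have hN : 0 < r + (s + 1) := by positivity
  set p := r / (r + (s + 1)) with hp
  set q := (s + 1) / (r + (s + 1)) with hq
  have hpq : p = 1 - q := by rw [hp, hq]; field_simp; ring
  have hp0 : 0 < p := by positivity
  have hq0 : 0 < q := by positivity
  set f : ℝ → ℝ := fun x => x ^ r * (1 - x) ^ s with hf
  have hfc : Continuous f := continuous_rpow_mul_one_sub_rpow hr.le hs.le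
  let F : ℝ → ℝ := fun u => ∫ x in (0 : ℝ)..u, f x
  have hF : ∀ u, HasDerivAt F (f u) u := fun u => hfc.integral_hasStrictDerivAt 0 u |>.hasDerivAt
  let y : ℝ → ℝ := fun x => 1 - q ^ 2 / (1 - x)
  have hy : ∀ x ∈ Set.Icc 0 p, HasDerivAt y (-(q ^ 2 / (1 - x) ^ 2)) x := by
    intro x hx
    have h1 : 1 - x ≠ 0 := by linarith [hx.2]
    refine (((hasDerivAt_const x (q ^ 2)).div ((hasDerivAt_id x).const_sub 1) h1).const_sub
      1).congr_deriv ?_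
    simp only [id]
    ring
  have hH : ∀ x ∈ Set.Icc 0 p, HasDerivAt (fun x => F (y x) + F x)
      (f (y x) * -(q ^ 2 / (1 - x) ^ 2) + f x) x :=
    fun x hx => ((hF (y x)).comp x (hy x hx)).add (hF x)
  have hanti : StrictAntiOn (fun x => F (y x) + F x) (Set.Icc 0 p) := by
    refine strictAntiOn_of_deriv_neg (convex_Icc 0 p)
      (fun x hx => (hH x hx).continuousAt.continuousWithinAt) fun x hx => ?_
    rw [interior_Icc] at hx
    rw [(hH x ⟨hx.1.le, hx.2.le⟩).deriv]
    have hx1 : 0 < 1 - x := by linarith [hx.2]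
    have hlt := rpow_mul_rpow_lt_reflection hr (by positivity : 0 < s + 1) hx.1 hx.2
    rw [← hq, rpow_add_one hx1.ne', rpow_add_one (by positivity : q ^ 2 / (1 - x) ≠ 0)] at hlt
    have e1 : f (y x) = (1 - q ^ 2 / (1 - x)) ^ r * (q ^ 2 / (1 - x)) ^ s := by
      simp only [hf, y, sub_sub_cancel]
    have key : f (y x) * -(q ^ 2 / (1 - x) ^ 2) + f x =
        (x ^ r * ((1 - x) ^ s * (1 - x)) - (1 - q ^ 2 / (1 - x)) ^ r *
          ((q ^ 2 / (1 - x)) ^ s * (q ^ 2 / (1 - x)))) / (1 - x) := by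
      rw [e1]
      simp only [hf]
      generalize (1 - q ^ 2 / (1 - x)) ^ r = A
      generalize (q ^ 2 / (1 - x)) ^ s = B
      field_simp
      ring
    rw [key]
    exact div_neg_of_neg_of_pos (by linarith) hx1
  have hlt := hanti ⟨le_rfl, hp0.le⟩ ⟨hp0.le, le_rfl⟩ hp0
  have yp : y p = p := by
    simp only [y, hpq, sub_sub_cancel]
    field_simp
  have y0 : y 0 = 1 - q ^ 2 := by simp [y]
  have F0 : F 0 = 0 := intervalIntegral.integral_same
  simp only [yp, y0, F0] at hlt
  have hle : F (1 - q ^ 2) ≤ F 1 := by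
    have hq1 : q < 1 := by linarith
    exact integral_rpow_mul_one_sub_rpow_mono hr.le hs.le (by nlinarith) (by nlinarith) le_rfl
  change 2 * F p < F 1
  linarith

/-- A median of the `Beta(r + 1, s + 1)` distribution exceeds `r / (r + s + 1)`. -/
lemma lt_of_integral_rpow_mul_one_sub_rpow_eq_half {r s m : ℝ} (hr : 0 < r) (hs : 0 < s)
    (hm : m ∈ Set.Ioo (0 : ℝ) 1)
    (hmed : ∫ x in (0 : ℝ)..m, x ^ r * (1 - x) ^ s =
      (1 / 2) * ∫ x in (0 : ℝ)..1, x ^ r * (1 - x) ^ s) :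
    r / (r + (s + 1)) < m := by
  by_contra! hle
  have hp1 : r / (r + (s + 1)) ≤ 1 := (div_le_one (by positivity)).2 (by linarith)
  have hmono := integral_rpow_mul_one_sub_rpow_mono hr.le hs.le hm.1.le hle hp1
  linarith [two_mul_integral_rpow_mul_one_sub_rpow_lt hr hs]

lemma integral_one_sub_eq_half {r s m : ℝ} (hr : 0 < r) (hs : 0 < s)
    (hmed : ∫ x in (0 : ℝ)..m, x ^ r * (1 - x) ^ s =
      (1 / 2) * ∫ x in (0 : ℝ)..1, x ^ r * (1 - x) ^ s) :
    ∫ x in (0 : ℝ)..(1 - m), x ^ s * (1 - x) ^ r =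
      (1 / 2) * ∫ x in (0 : ℝ)..1, x ^ s * (1 - x) ^ r := by
  have hrefl : ∀ u : ℝ, ∫ x in (0 : ℝ)..u, x ^ s * (1 - x) ^ r =
      ∫ x in (1 - u)..1, x ^ r * (1 - x) ^ s := fun u => by
    have := intervalIntegral.integral_comp_sub_left (a := 0) (b := u)
      (fun x : ℝ => x ^ r * (1 - x) ^ s) 1
    simpa only [sub_sub_cancel, sub_zero, mul_comm] using this
  have hint : ∀ u v, IntervalIntegrable (fun x : ℝ => x ^ r * (1 - x) ^ s)
      MeasureTheory.volume u v :=
    (continuous_rpow_mul_one_sub_rpow hr.le hs.le).intervalIntegrable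
  rw [hrefl, hrefl, sub_sub_cancel, sub_self]
  linarith [intervalIntegral.integral_add_adjacent_intervals (hint 0 m) (hint m 1)]

/-- For `c_l, c_u > 0`, `1 ≤ k ≤ n`, and Beta shape parameters `a = n c_l + k` and
`b = n c_u + n + 1 − k` both exceeding `1`, any median `m ∈ (0,1)` of the `Beta(a,b)`
distribution satisfies
`(c_l + (k−1)/n)/(c_l + c_u + 1) < m < (c_l + k/n)/(c_l + c_u + 1)`. -/
theorem stmt10 (cl cu : ℝ) (hcl : 0 < cl) (hcu : 0 < cu) (n k : ℕ)
    (hn : 1 ≤ n) (hk1 : 1 ≤ k) (hkn : k ≤ n)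
    (a b : ℝ) (ha : a = (n : ℝ) * cl + k) (hb : b = (n : ℝ) * cu + n + 1 - k)
    (ha1 : 1 < a) (hb1 : 1 < b)
    (m : ℝ) (hm : m ∈ Set.Ioo (0 : ℝ) 1)
    (hmed : ∫ x in (0 : ℝ)..m, x ^ (a - 1) * (1 - x) ^ (b - 1) =
      (1 / 2) * ∫ x in (0 : ℝ)..1, x ^ (a - 1) * (1 - x) ^ (b - 1)) :
    (cl + ((k : ℝ) - 1) / n) / (cl + cu + 1) < m ∧
      m < (cl + (k : ℝ) / n) / (cl + cu + 1) := by
  have hn0 : (0 : ℝ) < n := by exact_mod_cast hn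
  have hC : 0 < cl + cu + 1 := by positivity
  constructor
  · have h := lt_of_integral_rpow_mul_one_sub_rpow_eq_half (sub_pos.2 ha1) (sub_pos.2 hb1) hm hmed
    convert h using 1
    have : a - 1 + (b - 1 + 1) = n * (cl + cu + 1) := by rw [ha, hb]; ring
    rw [this, ha]
    field_simp
    ring
  · have h := lt_of_integral_rpow_mul_one_sub_rpow_eq_half (sub_pos.2 hb1) (sub_pos.2 ha1)
      (m := 1 - m) ⟨by linarith [hm.2], by linarith [hm.1]⟩
      (integral_one_sub_eq_half (sub_pos.2 ha1) (sub_pos.2 hb1) hmed)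
    have : b - 1 + (a - 1 + 1) = n * (cl + cu + 1) := by rw [ha, hb]; ring
    have e : (cl + (k : ℝ) / n) / (cl + cu + 1) = 1 - (b - 1) / (b - 1 + (a - 1 + 1)) := by
      rw [this, hb]
      field_simp
      ring
    linarith
end

section
/- Let τ_l < τ_u be real numbers, let c_l = Φ(τ_l)/(Φ(τ_u) − Φ(τ_l)) and c_u = (1 − Φ(τ_u))/(Φ(τ_u) − Φ(τ_l)), and let J(p) = Φ⁻¹(Φ(τ_l) + p(Φ(τ_u) − Φ(τ_l))) for p ∈ [0,1]. Let n ≥ 1 be an integer and let k be an integer with 1 ≤ k ≤ n, and suppose n c_l + k > 1 and n c_u + n + 1 − k > 1. If m is the median of the Beta(n c_l + k, n c_u + n + 1 − k) distribution and ξ = Φ⁻¹(m), then J((k−1)/n) < ξ < J(k/n). -/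
open Real

/-- Logarithmic form of the comparison of `x ^ a * (1 - x) ^ c` at `q ^ 2 / x` and at `x`,
where `q` is the point at which this function is maximal. -/
theorem log_reflect_lt {a c q x : ℝ} (hc : 0 < c) (hq0 : 0 < q) (hq1 : q < 1)
    (hq : a * (1 - q) = c * q) (hqx : q < x) (hx1 : x < 1) :
    a * log x + c * log (1 - x) <
      a * (2 * log q - log x) + c * (log (x - q ^ 2) - log x) := by
  have hderiv : ∀ y ∈ Set.Ico q 1, HasDerivAt
      (fun y => a * (2 * log q - log y) + c * (log (y - q ^ 2) - log y)
        - (a * log y + c * log (1 - y)))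
      (a * (0 - y⁻¹) + c * (1 / (y - q ^ 2) - y⁻¹) - (a * y⁻¹ + c * (-1 / (1 - y)))) y := by
    intro y hy
    have hy0 : 0 < y := hq0.trans_le hy.1
    have h1 : 0 < y - q ^ 2 := by nlinarith [hy.1]
    have h2 : 0 < 1 - y := sub_pos.2 hy.2
    have hl := Real.hasDerivAt_log hy0.ne'
    have hl1 := ((hasDerivAt_id y).sub_const (q ^ 2)).log h1.ne'
    have hl2 := ((hasDerivAt_id y).const_sub 1).log h2.ne'
    exact ((((hasDerivAt_const y (2 * log q)).sub hl).const_mul a).add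
      ((hl1.sub hl).const_mul c)).sub ((hl.const_mul a).add (hl2.const_mul c))
  have hmono := strictMonoOn_of_deriv_pos (convex_Ico q 1)
    (fun y hy => (hderiv y hy).continuousAt.continuousWithinAt) (by
      intro y hy
      rw [interior_Ico] at hy
      rw [(hderiv y ⟨hy.1.le, hy.2⟩).deriv]
      have hy0 : 0 < y := hq0.trans hy.1
      have h1 : 0 < y - q ^ 2 := by nlinarith [hy.1]
      have h2 : 0 < 1 - y := sub_pos.2 hy.2
      have h3 : 0 < 1 - q := sub_pos.2 hq1
      have ha : a = c * q / (1 - q) := by rw [eq_div_iff h3.ne', hq]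
      have key : a * (0 - y⁻¹) + c * (1 / (y - q ^ 2) - y⁻¹) - (a * y⁻¹ + c * (-1 / (1 - y)))
          = c * (1 + q) * (y - q) ^ 2 / (y * (y - q ^ 2) * (1 - y) * (1 - q)) := by
        rw [ha]; field_simp; ring
      rw [key]
      have := sub_pos.2 hy.1
      positivity)
  have hlt := hmono ⟨le_rfl, hq1⟩ ⟨hqx.le, hx1⟩ hqx
  have hlog : log (q - q ^ 2) = log q + log (1 - q) := by
    rw [← Real.log_mul hq0.ne' (sub_pos.2 hq1).ne']; ring_nf
  simp only [hlog] at hlt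
  linarith

/-- The beta density at `x` lies below the pullback of the beta density under the reflection
`x ↦ q ^ 2 / x`, for `x` to the right of `q = a / (a + b - 1)`. -/
theorem beta_density_reflect_lt {a b q x : ℝ} (hb : 1 < b) (hq0 : 0 < q) (hq1 : q < 1)
    (hq : a * (1 - q) = (b - 1) * q) (hqx : q < x) (hx1 : x < 1) :
    x ^ (a - 1) * (1 - x) ^ (b - 1) <
      (q ^ 2 / x) ^ (a - 1) * (1 - q ^ 2 / x) ^ (b - 1) * (q ^ 2 / x ^ 2) := by
  have hx0 : 0 < x := hq0.trans hqx
  have h1 : 0 < x - q ^ 2 := by nlinarith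
  have h2 : 0 < 1 - x := sub_pos.2 hx1
  have h3 : 1 - q ^ 2 / x = (x - q ^ 2) / x := by field_simp
  have h4 : 0 < (x - q ^ 2) / x := by positivity
  rw [h3, ← Real.log_lt_log_iff (by positivity) (by positivity),
    Real.log_mul (by positivity) (by positivity), Real.log_mul (by positivity) (by positivity),
    Real.log_mul (by positivity) (by positivity), Real.log_rpow hx0, Real.log_rpow h2,
    Real.log_rpow (by positivity), Real.log_rpow h4,
    Real.log_div (by positivity) hx0.ne', Real.log_div h1.ne' hx0.ne',
    Real.log_div (by positivity) (by positivity), Real.log_pow, Real.log_pow]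
  have := log_reflect_lt (a := a) (sub_pos.2 hb) hq0 hq1 hq hqx hx1
  push_cast
  linarith

theorem continuous_beta_density {a b : ℝ} (ha : 1 < a) (hb : 1 < b) :
    Continuous fun x : ℝ => x ^ (a - 1) * (1 - x) ^ (b - 1) :=
  (continuous_id.rpow_const fun _ => Or.inr (sub_pos.2 ha).le).mul
    ((continuous_const.sub continuous_id).rpow_const fun _ => Or.inr (sub_pos.2 hb).le)

/-- If a nonnegative function lies below its pullback under `x ↦ q ^ 2 / x` on `(q, 1)`,
then its integral over `[q, 1]` is smaller than its integral over `[0, q]`. -/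
theorem integral_upper_lt_lower_of_reflect {f : ℝ → ℝ} {q : ℝ} (hf : Continuous f)
    (hpos : ∀ x ∈ Set.Icc (0 : ℝ) 1, 0 ≤ f x) (hq0 : 0 < q) (hq1 : q < 1)
    (hlt : ∀ x, q < x → x < 1 → f x < f (q ^ 2 / x) * (q ^ 2 / x ^ 2)) :
    ∫ x in q..1, f x < ∫ x in 0..q, f x := by
  have hint : ∀ u v : ℝ, IntervalIntegrable f MeasureTheory.volume u v := fun u v =>
    hf.intervalIntegrable u v
  have hprim : ∀ y, HasDerivAt (fun y => ∫ x in q..y, f x) (f y) y := fun y =>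
    (hf.integral_hasStrictDerivAt q y).hasDerivAt
  have hderiv : ∀ y ∈ Set.Icc q 1, HasDerivAt
      (fun y => -(∫ x in q..(q ^ 2 / y), f x) - ∫ x in q..y, f x)
      (-(f (q ^ 2 / y) * (q ^ 2 * (-(y ^ 2)⁻¹))) - f y) y := by
    intro y hy
    have hy0 : y ≠ 0 := (hq0.trans_le hy.1).ne'
    have hinv : HasDerivAt (fun y => q ^ 2 / y) (q ^ 2 * (-(y ^ 2)⁻¹)) y := by
      simpa only [div_eq_mul_inv] using (hasDerivAt_inv hy0).const_mul (q ^ 2)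
    exact ((hprim _).comp y hinv).neg.sub (hprim y)
  have hmono := strictMonoOn_of_deriv_pos (convex_Icc q 1)
    (fun y hy => (hderiv y hy).continuousAt.continuousWithinAt) (by
      intro y hy
      rw [interior_Icc] at hy
      rw [(hderiv y ⟨hy.1.le, hy.2.le⟩).deriv]
      have := hlt y hy.1 hy.2
      rw [div_eq_mul_inv (q ^ 2) (y ^ 2)] at this
      linarith)
  have hH := hmono ⟨le_rfl, hq1.le⟩ ⟨hq1.le, le_rfl⟩ hq1
  have hqq : q ^ 2 / q = q := by field_simp
  simp only [hqq, div_one, intervalIntegral.integral_same, neg_zero, sub_zero] at hH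
  rw [← intervalIntegral.integral_symm] at hH
  have hsplit := intervalIntegral.integral_add_adjacent_intervals (hint 0 (q ^ 2)) (hint (q ^ 2) q)
  have hnonneg : 0 ≤ ∫ x in 0..(q ^ 2), f x :=
    intervalIntegral.integral_nonneg (sq_nonneg q) fun x hx =>
      hpos x ⟨hx.1, hx.2.trans (by nlinarith)⟩
  linarith

theorem beta_integral_upper_lt_lower {a b : ℝ} (ha : 1 < a) (hb : 1 < b) :
    ∫ x in (a / (a + b - 1))..1, x ^ (a - 1) * (1 - x) ^ (b - 1) <
      ∫ x in (0 : ℝ)..(a / (a + b - 1)), x ^ (a - 1) * (1 - x) ^ (b - 1) := by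
  have hab : 0 < a + b - 1 := by linarith
  obtain ⟨q, hqdef⟩ : ∃ q, q = a / (a + b - 1) := ⟨_, rfl⟩
  rw [← hqdef]
  have hq0 : 0 < q := by rw [hqdef]; exact div_pos (by linarith) hab
  have hq1 : q < 1 := by rw [hqdef, div_lt_one hab]; linarith
  have hq : a * (1 - q) = (b - 1) * q := by rw [hqdef]; field_simp; ring
  exact integral_upper_lt_lower_of_reflect (continuous_beta_density ha hb) (fun x hx =>
    mul_nonneg (Real.rpow_nonneg hx.1 _) (Real.rpow_nonneg (sub_nonneg.2 hx.2) _)) hq0 hq1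
    fun x => beta_density_reflect_lt hb hq0 hq1 hq

/-- The median of the beta distribution lies to the left of `a / (a + b - 1)`. -/
theorem beta_median_lt {a b m : ℝ} (ha : 1 < a) (hb : 1 < b) (hm : m ≤ 1)
    (hmed : ∫ x in (0 : ℝ)..m, x ^ (a - 1) * (1 - x) ^ (b - 1) =
      (1 / 2) * ∫ x in (0 : ℝ)..1, x ^ (a - 1) * (1 - x) ^ (b - 1)) :
    m < a / (a + b - 1) := by
  by_contra! hle
  have hint := fun u v => (continuous_beta_density ha hb).intervalIntegrable
    (μ := MeasureTheory.volume) u v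
  have hq0 : 0 < a / (a + b - 1) := div_pos (by linarith) (by linarith)
  have h1 := intervalIntegral.integral_add_adjacent_intervals
    (hint 0 (a / (a + b - 1))) (hint (a / (a + b - 1)) 1)
  have h2 := intervalIntegral.integral_add_adjacent_intervals
    (hint 0 (a / (a + b - 1))) (hint (a / (a + b - 1)) m)
  have h3 : 0 ≤ ∫ x in (a / (a + b - 1))..m, x ^ (a - 1) * (1 - x) ^ (b - 1) :=
    intervalIntegral.integral_nonneg hle fun x hx =>
      mul_nonneg (Real.rpow_nonneg (hq0.le.trans hx.1) _)
        (Real.rpow_nonneg (sub_nonneg.2 (hx.2.trans hm)) _)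
  have := beta_integral_upper_lt_lower ha hb
  linarith

/-- The median of the beta distribution lies to the right of `(a - 1) / (a + b - 1)`. -/
theorem lt_beta_median {a b m : ℝ} (ha : 1 < a) (hb : 1 < b) (hm : 0 ≤ m)
    (hmed : ∫ x in (0 : ℝ)..m, x ^ (a - 1) * (1 - x) ^ (b - 1) =
      (1 / 2) * ∫ x in (0 : ℝ)..1, x ^ (a - 1) * (1 - x) ^ (b - 1)) :
    (a - 1) / (a + b - 1) < m := by
  have hrefl : ∀ u v : ℝ, ∫ x in u..v, x ^ (b - 1) * (1 - x) ^ (a - 1) =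
      ∫ x in (1 - v)..(1 - u), x ^ (a - 1) * (1 - x) ^ (b - 1) := fun u v => by
    rw [← intervalIntegral.integral_comp_sub_left
      (fun x : ℝ => x ^ (a - 1) * (1 - x) ^ (b - 1)) 1]
    simp only [sub_sub_cancel, mul_comm]
  have hsplit := intervalIntegral.integral_add_adjacent_intervals
    ((continuous_beta_density ha hb).intervalIntegrable (μ := MeasureTheory.volume) 0 m)
    ((continuous_beta_density ha hb).intervalIntegrable (μ := MeasureTheory.volume) m 1)
  have := beta_median_lt (m := 1 - m) hb ha (by linarith) (by
    rw [hrefl, hrefl, sub_sub_cancel, sub_zero, sub_self]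
    linarith)
  have hab : 0 < a + b - 1 := by linarith
  have heq : (a - 1) / (a + b - 1) = 1 - b / (b + a - 1) := by
    rw [add_comm b a]; field_simp; ring
  linarith

theorem stdPhi_eq_gaussianPDFReal : stdPhi = ProbabilityTheory.gaussianPDFReal 0 1 := by
  ext x
  simp [stdPhi, ProbabilityTheory.gaussianPDFReal]

theorem stdPhiCDF_eq_cdf :
    stdPhiCDF = ProbabilityTheory.cdf (ProbabilityTheory.gaussianReal 0 1) := by
  ext x
  rw [ProbabilityTheory.cdf_eq_real, MeasureTheory.measureReal_def,
    ProbabilityTheory.gaussianReal_apply_eq_integral 0 one_ne_zero, ENNReal.toReal_ofReal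
      (MeasureTheory.integral_nonneg (ProbabilityTheory.gaussianPDFReal_nonneg 0 1)),
    stdPhiCDF, stdPhi_eq_gaussianPDFReal]

theorem strictMono_stdPhiCDF : StrictMono stdPhiCDF := fun x y hxy => by
  rw [← sub_pos, stdPhiCDF_sub]
  exact intervalIntegral.intervalIntegral_pos_of_pos integrable_stdPhi.intervalIntegrable
    stdPhi_pos hxy

theorem exists_stdPhiCDF_eq {p : ℝ} (hp0 : 0 < p) (hp1 : p < 1) : ∃ x, stdPhiCDF x = p := by
  refine mem_range_of_exists_le_of_exists_ge continuous_stdPhiCDF ?_ ?_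
  · rw [stdPhiCDF_eq_cdf]
    exact ((ProbabilityTheory.tendsto_cdf_atBot _).eventually (eventually_le_nhds hp0)).exists
  · rw [stdPhiCDF_eq_cdf]
    exact ((ProbabilityTheory.tendsto_cdf_atTop _).eventually (eventually_ge_nhds hp1)).exists

theorem stdPhiCDF_inv_lt_inv {Φinv : ℝ → ℝ} (hΦinv : ∀ x : ℝ, Φinv (stdPhiCDF x) = x) {p q : ℝ}
    (hp : 0 < p) (hpq : p < q) (hq : q < 1) : Φinv p < Φinv q := by
  obtain ⟨x, rfl⟩ := exists_stdPhiCDF_eq hp (hpq.trans hq)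
  obtain ⟨y, rfl⟩ := exists_stdPhiCDF_eq (hp.trans hpq) hq
  rw [hΦinv, hΦinv]
  exact strictMono_stdPhiCDF.lt_iff_lt.1 hpq

/-- Let `c_l = Φ(τ_l)/(Φ(τ_u) − Φ(τ_l))`, `c_u = (1 − Φ(τ_u))/(Φ(τ_u) − Φ(τ_l))` and let
`J` be the quantile function of `TN(0,1,τ_l,τ_u)`.  If `m` is the median of the
`Beta(n c_l + k, n c_u + n + 1 − k)` distribution (both shape parameters exceeding `1`)
and `ξ = Φ⁻¹(m)`, then `J((k−1)/n) < ξ < J(k/n)`.  Here `Φinv` is the inverse of `Φ`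
(characterized by `Φinv ∘ Φ = id`). -/
theorem stmt17 (τl τu : ℝ) (h : τl < τu)
    (Φinv : ℝ → ℝ) (hΦinv : ∀ x : ℝ, Φinv (stdPhiCDF x) = x)
    (cl cu : ℝ)
    (hcl : cl = stdPhiCDF τl / (stdPhiCDF τu - stdPhiCDF τl))
    (hcu : cu = (1 - stdPhiCDF τu) / (stdPhiCDF τu - stdPhiCDF τl))
    (J : ℝ → ℝ)
    (hJ : ∀ p : ℝ, J p = Φinv (stdPhiCDF τl + p * (stdPhiCDF τu - stdPhiCDF τl)))
    (n k : ℕ) (hn : 1 ≤ n) (hk1 : 1 ≤ k) (hkn : k ≤ n)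
    (a b : ℝ) (ha : a = (n : ℝ) * cl + k) (hb : b = (n : ℝ) * cu + n + 1 - k)
    (ha1 : 1 < a) (hb1 : 1 < b)
    (m : ℝ) (hm : m ∈ Set.Ioo (0 : ℝ) 1)
    (hmed : ∫ x in (0 : ℝ)..m, x ^ (a - 1) * (1 - x) ^ (b - 1) =
      (1 / 2) * ∫ x in (0 : ℝ)..1, x ^ (a - 1) * (1 - x) ^ (b - 1))
    (ξ : ℝ) (hξ : ξ = Φinv m) :
    J (((k : ℝ) - 1) / n) < ξ ∧ ξ < J ((k : ℝ) / n) := by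
  have hD : 0 < stdPhiCDF τu - stdPhiCDF τl := sub_pos.2 (strictMono_stdPhiCDF h)
  have hn0 : (0 : ℝ) < n := by exact_mod_cast hn
  have hab : 0 < a + b - 1 := by linarith
  have hsum : a + b - 1 = n / (stdPhiCDF τu - stdPhiCDF τl) := by
    rw [ha, hb, hcl, hcu]; field_simp; ring
  have hlo : stdPhiCDF τl + ((k : ℝ) - 1) / n * (stdPhiCDF τu - stdPhiCDF τl) =
      (a - 1) / (a + b - 1) := by
    rw [hsum, ha, hcl]; field_simp; ring
  have hup : stdPhiCDF τl + (k : ℝ) / n * (stdPhiCDF τu - stdPhiCDF τl) =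
      a / (a + b - 1) := by
    rw [hsum, ha, hcl]; field_simp
  rw [hJ, hJ, hlo, hup, hξ]
  exact ⟨stdPhiCDF_inv_lt_inv hΦinv (div_pos (sub_pos.2 ha1) hab)
      (lt_beta_median ha1 hb1 hm.1.le hmed) hm.2,
    stdPhiCDF_inv_lt_inv hΦinv hm.1 (beta_median_lt ha1 hb1 hm.2.le hmed)
      ((div_lt_one hab).2 (by linarith))⟩
end
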